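/- arXiv:1205.6395 — 3 statements merged into one kernel-verified Lean document; each statement's English description precedes it below -/
import Mathlib

section
/- There exists a super-simple 2-(16,4,1) directed design (which has 40 blocks) whose smallest defining sets contain at least 20 blocks, i.e. at least half of the blocks. -/
open scoped Classical

/-- A block of size `k` on the point set `α`: a list of `k` distinct points. -/
def IsBlock {α : Type*} (k : ℕ) (b : List α) : Prop :=
  b.Nodup ∧ b.length = k

/-- A `t-(v,k,λ)` directed design whose point set is the whole (finite) type `α`
(so `v = Fintype.card α`): every ordered `t`-tuple of distinct points appears,
as a subsequence, in exactly `lam` blocks of the multiset `B`. -/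
def IsDD {α : Type*} (t k lam : ℕ) (B : Multiset (List α)) : Prop :=
  (∀ b ∈ B, IsBlock k b) ∧
    ∀ s : List α, s.Nodup → s.length = t →
      B.countP (fun b => s.Sublist b) = lam

/-- `S` is a defining set of the `t-(v,k,λ)` directed design with block multiset `B`:
`S` is a sub-multiset of `B`, and `B` is the unique block multiset of a
`t-(v,k,λ)DD` on the same point set containing `S`. -/
def IsDefiningSet {α : Type*} (t k lam : ℕ) (B S : Multiset (List α)) : Prop :=
  S ≤ B ∧ ∀ B' : Multiset (List α), IsDD t k lam B' → S ≤ B' → B' = B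

/-- A `(v,k,t)` directed trade `T₁ - T₂` of volume `s` on the point set `α`. -/
def IsTrade {α : Type*} (t k s : ℕ) (T₁ T₂ : Multiset (List α)) : Prop :=
  1 ≤ s ∧ Multiset.card T₁ = s ∧ Multiset.card T₂ = s ∧
    (∀ b ∈ T₁, IsBlock k b) ∧ (∀ b ∈ T₂, IsBlock k b) ∧
    (∀ b, b ∈ T₁ → b ∉ T₂) ∧
    ∀ l : List α, l.Nodup → l.length = t →
      T₁.countP (fun b => l.Sublist b) = T₂.countP (fun b => l.Sublist b)

/-- A multiset of blocks is super-simple if any two blocks (any sub-multiset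
consisting of two blocks) intersect, as point sets, in at most two points. -/
def SuperSimple {α : Type*} (B : Multiset (List α)) : Prop :=
  ∀ b₁ b₂ : List α, ({b₁, b₂} : Multiset (List α)) ≤ B →
    (b₁.toFinset ∩ b₂.toFinset).card ≤ 2

/-- A `2-(v,K,1)` design (pairwise balanced design) on the point type `β`. -/
def IsPBD {β : Type*} (K : Set ℕ) (D : Multiset (Finset β)) : Prop :=
  (∀ b ∈ D, b.card ∈ K) ∧
    ∀ x y : β, x ≠ y → D.countP (fun b => x ∈ b ∧ y ∈ b) = 1

/-- A `{K}`-GDD on the point type `β` with group multiset `Gs` and block multiset `Bs`. -/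
def IsGDD {β : Type*} (K : Set ℕ) (Gs Bs : Multiset (Finset β)) : Prop :=
  (∀ x : β, Gs.countP (fun G => x ∈ G) = 1) ∧
    (∀ b ∈ Bs, b.card ∈ K) ∧
    (∀ b ∈ Bs, ∀ G ∈ Gs, (b ∩ G).card ≤ 1) ∧
    (∀ x y : β, x ≠ y → (∀ G ∈ Gs, ¬(x ∈ G ∧ y ∈ G)) →
      Bs.countP (fun b => x ∈ b ∧ y ∈ b) = 1)

/-- A `4`-DGDD on the point type `β` with group multiset `Gs` and block multiset `B`:
the groups partition the points, no block meets a group twice, and every ordered pair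
of points from distinct groups appears in exactly one block. -/
def IsDGDD {β : Type*} (Gs : Multiset (Finset β)) (B : Multiset (List β)) : Prop :=
  (∀ x : β, Gs.countP (fun G => x ∈ G) = 1) ∧
    (∀ b ∈ B, IsBlock 4 b) ∧
    (∀ b ∈ B, ∀ G ∈ Gs, (b.toFinset ∩ G).card ≤ 1) ∧
    (∀ x y : β, x ≠ y → (∀ G ∈ Gs, ¬(x ∈ G ∧ y ∈ G)) →
      B.countP (fun b => [x, y].Sublist b) = 1)

/-- `S` is a defining set of the `4`-DGDD with groups `Gs` and block multiset `B`. -/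
def IsDGDDDefiningSet {β : Type*} (Gs : Multiset (Finset β)) (B S : Multiset (List β)) : Prop :=
  S ≤ B ∧ ∀ B' : Multiset (List β), IsDGDD Gs B' → S ≤ B' → B' = B

/-- Exchanging a trade contained in a directed design yields a directed design. -/
theorem IsDD.exchange_trade {α : Type*} [DecidableEq α] {t k lam s : ℕ}
    {B T₁ T₂ : Multiset (List α)} (hB : IsDD t k lam B) (hT : IsTrade t k s T₁ T₂)
    (hle : T₁ ≤ B) : IsDD t k lam (B - T₁ + T₂) := by
  obtain ⟨-, -, -, -, hb₂, -, hc⟩ := hT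
  refine ⟨fun b hb => ?_, fun l hl hlt => ?_⟩
  · rcases Multiset.mem_add.mp hb with h | h
    · exact hB.1 b (Multiset.mem_of_le (Multiset.sub_le_self _ _) h)
    · exact hb₂ b h
  · rw [Multiset.countP_add, ← hc l hl hlt, ← Multiset.countP_add, Multiset.sub_add_cancel hle]
    exact hB.2 l hl hlt

/-- A defining set meets every trade contained in the design. -/
theorem IsDefiningSet.exists_mem_trade {α : Type*} [DecidableEq α] {t k lam s : ℕ}
    {B S T₁ T₂ : Multiset (List α)} (hS : IsDefiningSet t k lam B S) (hB : IsDD t k lam B)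
    (hT : IsTrade t k s T₁ T₂) (hle : T₁ ≤ B) : ∃ b ∈ T₁, b ∈ S := by
  by_contra! hdisj
  have hsub : S ≤ B - T₁ := by
    refine Multiset.le_iff_count.mpr fun b => ?_
    rw [Multiset.count_sub]
    by_cases hb : b ∈ T₁
    · simp [Multiset.count_eq_zero_of_notMem (hdisj b hb)]
    · simpa [Multiset.count_eq_zero_of_notMem hb] using Multiset.count_le_of_le b hS.1
  have heq := hS.2 _ (hB.exchange_trade hT hle) (hsub.trans (Multiset.le_add_right _ _))
  have hT₂ : T₂ = T₁ :=
    add_left_cancel (heq.trans (Multiset.sub_add_cancel hle).symm)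
  obtain ⟨hs, hcard, -, -, -, hne, -⟩ := hT
  obtain ⟨b, hb⟩ := Multiset.card_pos_iff_exists_mem.mp (by lia : 0 < Multiset.card T₁)
  exact hne b hb (hT₂ ▸ hb)

/-- If a directed design contains `n` pairwise disjoint trades, each of its defining sets has
at least `n` blocks. -/
theorem IsDefiningSet.le_card_of_disjoint_trades {α : Type*} [DecidableEq α] {t k lam n : ℕ}
    {B S : Multiset (List α)} (hS : IsDefiningSet t k lam B S) (hB : IsDD t k lam B)
    (T T' : Fin n → Multiset (List α)) (hT : ∀ i, ∃ s, IsTrade t k s (T i) (T' i))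
    (hle : ∀ i, T i ≤ B) (hdisj : ∀ i j, ∀ b ∈ T i, b ∈ T j → i = j) :
    n ≤ Multiset.card S := by
  have hmeet : ∀ i, ∃ b ∈ T i, b ∈ S := fun i =>
    let ⟨_, h⟩ := hT i
    hS.exists_mem_trade hB h (hle i)
  choose f hfT hfS using hmeet
  have hinj : Function.Injective f := fun i j hij =>
    hdisj i j (f i) (hfT i) (hij ▸ hfT j)
  calc n = (Finset.univ.image f).card := by simp [Finset.card_image_of_injective _ hinj]
    _ ≤ S.toFinset.card := Finset.card_le_card fun b hb => by
        obtain ⟨i, -, rfl⟩ := Finset.mem_image.mp hb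
        simpa using hfS i
    _ ≤ Multiset.card S := Multiset.toFinset_card_le S

/-- Pairs of blocks of a `2-(16,4,1)DD`; in a row `(x, y, b, c)`, the points `x` and `y` are
adjacent in both blocks `b` and `c`, in opposite orders. -/
def linkedPairs : Fin 20 → Fin 16 × Fin 16 × List (Fin 16) × List (Fin 16) :=
  ![(6, 14, [10, 2, 6, 14], [9, 13, 14, 6]),
    (7, 10, [11, 3, 7, 10], [5, 14, 10, 7]),
    (8, 11, [12, 4, 8, 11], [6, 10, 11, 8]),
    (9, 12, [13, 0, 9, 12], [7, 11, 12, 9]),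
    (5, 13, [14, 1, 5, 13], [8, 12, 13, 5]),
    (0, 2, [0, 2, 1, 8], [14, 2, 0, 11]),
    (1, 3, [1, 3, 2, 9], [10, 3, 1, 12]),
    (2, 4, [2, 4, 3, 5], [11, 4, 2, 13]),
    (3, 0, [3, 0, 4, 6], [12, 0, 3, 14]),
    (4, 1, [4, 1, 0, 7], [13, 1, 4, 10]),
    (8, 3, [5, 15, 8, 3], [14, 9, 3, 8]),
    (9, 4, [6, 15, 9, 4], [10, 5, 4, 9]),
    (5, 0, [7, 15, 5, 0], [11, 6, 0, 5]),
    (6, 1, [8, 15, 6, 1], [12, 7, 1, 6]),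
    (7, 2, [9, 15, 7, 2], [13, 8, 2, 7]),
    (10, 0, [10, 0, 15, 13], [8, 9, 0, 10]),
    (11, 1, [11, 1, 15, 14], [9, 5, 1, 11]),
    (12, 2, [12, 2, 15, 10], [5, 6, 2, 12]),
    (13, 3, [13, 3, 15, 11], [6, 7, 3, 13]),
    (14, 4, [14, 4, 15, 12], [7, 8, 4, 14])]

/-- The two blocks of the `i`-th linked pair. -/
def linkedBlocks (i : Fin 20) : List (List (Fin 16)) :=
  [(linkedPairs i).2.2.1, (linkedPairs i).2.2.2]

/-- The two blocks of the `i`-th linked pair, with their common adjacent points exchanged. -/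
def swappedBlocks (i : Fin 20) : List (List (Fin 16)) :=
  (linkedBlocks i).map (List.map (Equiv.swap (linkedPairs i).1 (linkedPairs i).2.1))

/-- The blocks of a super-simple `2-(16,4,1)DD`. -/
def designBlocks : List (List (Fin 16)) :=
  (List.finRange 20).flatMap linkedBlocks

theorem isDD_designBlocks : IsDD 2 4 1 (designBlocks : Multiset (List (Fin 16))) := by
  have hblock : ∀ b ∈ designBlocks, b.Nodup ∧ b.length = 4 := by decide +kernel
  have hcount : ∀ x y : Fin 16, x ≠ y →
      designBlocks.countP (fun b => [x, y].Sublist b) = 1 := by decide +kernel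
  refine ⟨fun b hb => hblock b hb, fun l hl hlen => ?_⟩
  obtain ⟨x, y, rfl⟩ := List.length_eq_two.mp hlen
  rw [← hcount x y (by simpa using hl), ← Multiset.coe_countP]
  congr!

theorem isTrade_linkedBlocks (i : Fin 20) :
    IsTrade 2 4 2 (linkedBlocks i : Multiset (List (Fin 16))) (swappedBlocks i) := by
  have hblock : ∀ i, ∀ b ∈ linkedBlocks i ++ swappedBlocks i, b.Nodup ∧ b.length = 4 := by
    decide +kernel
  have hne : ∀ i, ∀ b ∈ linkedBlocks i, b ∉ swappedBlocks i := by decide +kernel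
  have hcount : ∀ i, ∀ x y : Fin 16, x ≠ y →
      (linkedBlocks i).countP (fun b => [x, y].Sublist b) =
        (swappedBlocks i).countP (fun b => [x, y].Sublist b) := by decide +kernel
  refine ⟨by norm_num, rfl, rfl, fun b hb => hblock i b (List.mem_append_left _ hb),
    fun b hb => hblock i b (List.mem_append_right _ hb), fun b hb => hne i b hb,
    fun l hl hlen => ?_⟩
  obtain ⟨x, y, rfl⟩ := List.length_eq_two.mp hlen
  have h := hcount i x y (by simpa using hl)
  rw [← Multiset.coe_countP, ← Multiset.coe_countP] at h
  convert h

theorem superSimple_designBlocks :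
    SuperSimple (designBlocks : Multiset (List (Fin 16))) := by
  have hpair : designBlocks.Pairwise fun b c => (b.toFinset ∩ c.toFinset).card ≤ 2 := by
    decide +kernel
  intro b c hbc
  have hsub : [b, c].Subperm designBlocks := hbc
  obtain ⟨l, hl, hsl⟩ := hsub
  have hl' := (hpair.sublist hsl).perm hl fun h => by rwa [Finset.inter_comm]
  have h := List.rel_of_pairwise_cons hl' (List.mem_singleton.mpr rfl)
  convert h

theorem linkedBlocks_le_designBlocks (i : Fin 20) :
    (linkedBlocks i : Multiset (List (Fin 16))) ≤ designBlocks :=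
  (List.sublist_flatten_of_mem
    (List.mem_map_of_mem (List.mem_finRange i))).subperm

theorem eq_of_mem_linkedBlocks :
    ∀ i j, ∀ b ∈ linkedBlocks i, b ∈ linkedBlocks j → i = j := by
  decide +kernel

/-- There is a super-simple `2-(16,4,1)DD` (with 40 blocks)
whose every defining set contains at least 20 blocks, i.e. at least half of the
blocks. -/
theorem stmt14 :
    ∃ B : Multiset (List (Fin 16)),
      IsDD 2 4 1 B ∧ SuperSimple B ∧ Multiset.card B = 40 ∧
      ∀ S : Multiset (List (Fin 16)), IsDefiningSet 2 4 1 B S →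
        20 ≤ Multiset.card S := by
  exact ⟨designBlocks, isDD_designBlocks, superSimple_designBlocks, rfl, fun S hS =>
    hS.le_card_of_disjoint_trades isDD_designBlocks (fun i => linkedBlocks i)
      (fun i => swappedBlocks i) (fun i => ⟨2, isTrade_linkedBlocks i⟩)
      linkedBlocks_le_designBlocks eq_of_mem_linkedBlocks⟩
end

section
/- There exists a super-simple 2-(19,4,1) directed design (which has 57 blocks) whose smallest defining sets contain at least 29 blocks; in particular its smallest defining sets contain more than half of the blocks. -/
open scoped Classical

theorem List.sublist_map_equiv_iff {α β : Type*} (e : α ≃ β) (l : List β) (b : List α) :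
    l.Sublist (b.map e) ↔ (l.map e.symm).Sublist b := by
  constructor
  · intro h
    simpa using h.map e.symm
  · intro h
    simpa using h.map e

theorem Multiset.countP_sublist_map_equiv {α β : Type*} (e : α ≃ β) (l : List β)
    (T : Multiset (List α)) :
    (T.map (List.map e)).countP (fun b => l.Sublist b) =
      T.countP (fun b => (l.map e.symm).Sublist b) := by
  rw [Multiset.countP_map, Multiset.countP_eq_card_filter]
  simp only [List.sublist_map_equiv_iff]

theorem IsBlock.map {α β : Type*} {k : ℕ} {b : List α} (hb : IsBlock k b) (e : α ≃ β) :
    IsBlock k (b.map e) :=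
  ⟨hb.1.map e.injective, by simpa using hb.2⟩

theorem IsTrade.map {α β : Type*} {t k s : ℕ} {T₁ T₂ : Multiset (List α)}
    (h : IsTrade t k s T₁ T₂) (e : α ≃ β) :
    IsTrade t k s (T₁.map (List.map e)) (T₂.map (List.map e)) := by
  obtain ⟨hs, hc₁, hc₂, hb₁, hb₂, hd, hcount⟩ := h
  refine ⟨hs, by simpa using hc₁, by simpa using hc₂, ?_, ?_, ?_, ?_⟩
  · simp only [Multiset.mem_map]
    rintro _ ⟨b, hb, rfl⟩
    exact (hb₁ b hb).map e
  · simp only [Multiset.mem_map]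
    rintro _ ⟨b, hb, rfl⟩
    exact (hb₂ b hb).map e
  · simp only [Multiset.mem_map]
    rintro _ ⟨b, hb, rfl⟩ ⟨c, hc, hcb⟩
    exact hd b hb (List.map_injective_iff.2 e.injective hcb ▸ hc)
  · intro l hl hlt
    rw [Multiset.countP_sublist_map_equiv, Multiset.countP_sublist_map_equiv]
    exact hcount _ (hl.map e.symm.injective) (by simpa using hlt)

/-- Replacing one half of a trade by the other turns a directed design into a directed design. -/
theorem IsTrade.isDD_add {α : Type*} {t k lam s : ℕ} {R T₁ T₂ : Multiset (List α)}
    (hT : IsTrade t k s T₁ T₂) (h : IsDD t k lam (R + T₁)) : IsDD t k lam (R + T₂) := by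
  obtain ⟨-, -, -, -, hb₂, -, hcount⟩ := hT
  refine ⟨fun b hb => ?_, fun l hl hlt => ?_⟩
  · rcases Multiset.mem_add.1 hb with hb | hb
    · exact h.1 b (Multiset.mem_add.2 (Or.inl hb))
    · exact hb₂ b hb
  · rw [Multiset.countP_add, ← hcount l hl hlt, ← Multiset.countP_add]
    exact h.2 l hl hlt

/-- A defining set meets every trade contained in the design. -/
theorem IsDefiningSet.exists_mem_of_isTrade {α : Type*} {t k lam s : ℕ}
    {B S T₁ T₂ : Multiset (List α)} (hS : IsDefiningSet t k lam B S) (hB : IsDD t k lam B)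
    (hT : IsTrade t k s T₁ T₂) (hle : T₁ ≤ B) : ∃ b ∈ T₁, b ∈ S := by
  by_contra! hdisj
  obtain ⟨R, rfl⟩ := Multiset.le_iff_exists_add.1 hle
  rw [add_comm T₁ R] at hS hB
  have hSR : S ≤ R := by
    rw [Multiset.le_iff_count]
    intro b
    by_cases hb : b ∈ T₁
    · simp [Multiset.count_eq_zero.2 (hdisj b hb)]
    · simpa [Multiset.count_eq_zero.2 hb] using Multiset.count_le_of_le b hS.1
  have heq : T₂ = T₁ := add_left_cancel
    (hS.2 _ (hT.isDD_add hB) (hSR.trans (Multiset.le_add_right R T₂)))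
  obtain ⟨hs, hc₁, -, -, -, hd, -⟩ := hT
  obtain ⟨b, hb⟩ := Multiset.card_pos_iff_exists_mem.1 (hc₁ ▸ hs : 0 < Multiset.card T₁)
  exact hd b hb (heq ▸ hb)

/-- A two-element multiset lying below a multiset without repetitions has distinct members. -/
theorem Multiset.Nodup.ne_of_pair_le {α : Type*} {B : Multiset α} (hB : B.Nodup) {a b : α}
    (h : ({a, b} : Multiset α) ≤ B) : a ≠ b := by
  rintro rfl
  simpa using Multiset.nodup_of_le h hB

namespace DirectedDesign19

/-- The three base blocks, which are the images of `[1, 0, 11, 6]` under multiplication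
by the cube roots of unity modulo 19. -/
def baseBlock : Fin 3 → List (Fin 19) := ![[1, 0, 11, 6], [7, 0, 1, 4], [11, 0, 7, 9]]

/-- The base blocks with their first two points exchanged. -/
def swapFirst : Fin 3 → List (Fin 19) := ![[0, 1, 11, 6], [0, 7, 1, 4], [0, 11, 7, 9]]

/-- The base blocks with their two middle points exchanged. -/
def swapMiddle : Fin 3 → List (Fin 19) := ![[1, 11, 0, 6], [7, 1, 0, 4], [11, 7, 0, 9]]

/-- The translates of the base blocks. -/
def block (p : Fin 3 × Fin 19) : List (Fin 19) := (baseBlock p.1).map (Equiv.addRight p.2)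

/-- The directed design developed from the base blocks. -/
def blocks : Multiset (List (Fin 19)) := (Finset.univ : Finset (Fin 3 × Fin 19)).val.map block

theorem block_injective : Function.Injective block := by
  unfold Function.Injective
  decide +kernel

theorem blocks_nodup : blocks.Nodup := Finset.univ.nodup.map block_injective

theorem mem_blocks {b : List (Fin 19)} : b ∈ blocks ↔ ∃ p, block p = b := by
  simp [blocks]

theorem map_addRight_block (p : Fin 3 × Fin 19) (i : Fin 19) :
    (block p).map (Equiv.addRight i) = block (p.1, p.2 + i) := by
  simp [block]

theorem map_addRight_blocks (i : Fin 19) :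
    blocks.map (List.map (Equiv.addRight i)) = blocks := by
  have h := Multiset.map_univ_val_equiv ((Equiv.refl (Fin 3)).prodCongr (Equiv.addRight i))
  conv_rhs => rw [blocks, ← h]
  rw [blocks, Multiset.map_map, Multiset.map_map]
  exact Multiset.map_congr rfl fun p _ => map_addRight_block p i

theorem countP_pair_zero : ∀ y : Fin 19, 0 ≠ y →
    blocks.countP (fun b => [0, y].Sublist b) = 1 := by
  decide +kernel

theorem countP_pair {x y : Fin 19} (h : x ≠ y) :
    blocks.countP (fun b => [x, y].Sublist b) = 1 := by
  have hshift : [x, y].map (Equiv.addRight x).symm = [0, y - x] := by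
    simp [sub_eq_add_neg]
  have hcount := Multiset.countP_sublist_map_equiv (Equiv.addRight x) [x, y] blocks
  rw [map_addRight_blocks, hshift] at hcount
  convert hcount.trans ?_
  convert countP_pair_zero (y - x) (sub_ne_zero.2 h.symm).symm

theorem isDD_blocks : IsDD 2 4 1 blocks := by
  refine ⟨fun b hb => ?_, fun l hl hlt => ?_⟩
  · obtain ⟨⟨k, i⟩, rfl⟩ := mem_blocks.1 hb
    have hbase : ∀ k, (baseBlock k).Nodup ∧ (baseBlock k).length = 4 := by decide
    exact IsBlock.map (hbase k) _
  · obtain ⟨x, y, rfl⟩ := List.length_eq_two.1 hlt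
    convert countP_pair (by simpa using hl : x ≠ y)

theorem card_inter_le_zero : ∀ k q, (k, 0) ≠ q →
    ((block (k, 0)).toFinset ∩ (block q).toFinset).card ≤ 2 := by
  decide +kernel

theorem card_inter_le {p q : Fin 3 × Fin 19} (h : p ≠ q) :
    ((block p).toFinset ∩ (block q).toFinset).card ≤ 2 := by
  obtain ⟨k, i⟩ := p
  obtain ⟨m, j⟩ := q
  have hne : (k, 0) ≠ (m, j - i) := fun heq => h <| by
    obtain ⟨rfl, hij⟩ := Prod.mk.inj heq
    rw [sub_eq_zero.1 hij.symm]
  have hk : block (k, i) = (block (k, 0)).map (Equiv.addRight i) := by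
    rw [map_addRight_block]
    simp
  have hm : block (m, j) = (block (m, j - i)).map (Equiv.addRight i) := by
    rw [map_addRight_block]
    simp
  have himage : ∀ b : List (Fin 19),
      (b.map (Equiv.addRight i)).toFinset = b.toFinset.image (Equiv.addRight i) := by
    intro b
    ext x
    simp only [List.mem_toFinset, List.mem_map, Finset.mem_image]
  rw [hk, hm, himage, himage, ← Finset.image_inter _ _ (Equiv.injective _)]
  exact Finset.card_image_le.trans (card_inter_le_zero k _ hne)

theorem superSimple_blocks : SuperSimple blocks := by
  intro b₁ b₂ h
  have hne := blocks_nodup.ne_of_pair_le h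
  obtain ⟨p, rfl⟩ := mem_blocks.1 (Multiset.mem_of_le h (by simp : b₁ ∈ _))
  obtain ⟨q, rfl⟩ := mem_blocks.1 (Multiset.mem_of_le h (by simp : b₂ ∈ _))
  convert card_inter_le (fun hpq : p = q => hne (congrArg block hpq))

theorem countP_trade : ∀ (k : Fin 3) (x y : Fin 19), x ≠ y →
    ({baseBlock k, baseBlock (k + 1)} : Multiset (List (Fin 19))).countP
        (fun b => [x, y].Sublist b) =
      ({swapFirst k, swapMiddle (k + 1)} : Multiset (List (Fin 19))).countP
        (fun b => [x, y].Sublist b) := by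
  decide +kernel

theorem isTrade_base (k : Fin 3) :
    IsTrade 2 4 2 {baseBlock k, baseBlock (k + 1)} {swapFirst k, swapMiddle (k + 1)} := by
  refine ⟨by norm_num, by simp, by simp, ?_, ?_, ?_, fun l hl hlt => ?_⟩
  · unfold IsBlock
    revert k
    decide
  · unfold IsBlock
    revert k
    decide
  · revert k
    decide
  · obtain ⟨x, y, rfl⟩ := List.length_eq_two.1 hlt
    convert countP_trade k x y (by simpa using hl)

theorem pair_le_blocks (k : Fin 3) (i : Fin 19) :
    ({block (k, i), block (k + 1, i)} : Multiset (List (Fin 19))) ≤ blocks := by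
  have hne : (k, i) ≠ (k + 1, i) := by
    simp
  have hnd : ({block (k, i), block (k + 1, i)} : Multiset (List (Fin 19))).Nodup := by
    simpa using block_injective.ne hne
  rw [Multiset.le_iff_subset hnd]
  intro b hb
  simp only [Multiset.insert_eq_cons, Multiset.mem_cons, Multiset.mem_singleton] at hb
  rcases hb with rfl | rfl <;> exact mem_blocks.2 ⟨_, rfl⟩

theorem mem_or_mem_of_isDefiningSet {S : Multiset (List (Fin 19))}
    (hS : IsDefiningSet 2 4 1 blocks S) (k : Fin 3) (i : Fin 19) :
    block (k, i) ∈ S ∨ block (k + 1, i) ∈ S := by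
  have hT := (isTrade_base k).map (Equiv.addRight i)
  obtain ⟨b, hb, hbS⟩ := hS.exists_mem_of_isTrade isDD_blocks hT
    (by simpa [block] using pair_le_blocks k i)
  simp only [Multiset.insert_eq_cons, Multiset.map_cons, Multiset.map_singleton,
    Multiset.mem_cons, Multiset.mem_singleton] at hb
  rcases hb with rfl | rfl
  · exact Or.inl hbS
  · exact Or.inr hbS

theorem two_le_card_of_cyclic_cover : ∀ K : Finset (Fin 3),
    (∀ k, k ∈ K ∨ k + 1 ∈ K) → 2 ≤ K.card := by
  decide

theorem card_of_isDefiningSet {S : Multiset (List (Fin 19))}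
    (hS : IsDefiningSet 2 4 1 blocks S) : 38 ≤ Multiset.card S := by
  let F : Fin 19 → Finset (Fin 3) := fun i => Finset.univ.filter fun k => block (k, i) ∈ S
  have hF : ∀ i, 2 ≤ (F i).card := fun i =>
    two_le_card_of_cyclic_cover _ fun k => by
      simpa [F] using mem_or_mem_of_isDefiningSet hS k i
  calc 38 = ∑ _i : Fin 19, 2 := by simp
    _ ≤ ∑ i, (F i).card := Finset.sum_le_sum fun i _ => hF i
    _ = (Finset.univ.sigma F).card := (Finset.card_sigma _ _).symm
    _ ≤ S.toFinset.card := by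
      refine Finset.card_le_card_of_injOn (fun x => block (x.2, x.1)) ?_ ?_
      · rintro ⟨i, k⟩ hx
        simpa [F] using hx
      · rintro ⟨i, k⟩ - ⟨j, m⟩ - h
        obtain ⟨rfl, rfl⟩ := Prod.mk.inj (block_injective h)
        rfl
    _ ≤ Multiset.card S := S.toFinset_card_le

end DirectedDesign19

/-- There is a super-simple `2-(19,4,1)DD` (with 57 blocks)
whose every defining set contains at least 29 blocks (in particular, more than
half of the blocks). -/
theorem stmt15 :
    ∃ B : Multiset (List (Fin 19)),
      IsDD 2 4 1 B ∧ SuperSimple B ∧ Multiset.card B = 57 ∧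
      ∀ S : Multiset (List (Fin 19)), IsDefiningSet 2 4 1 B S →
        29 ≤ Multiset.card S :=
  ⟨DirectedDesign19.blocks, DirectedDesign19.isDD_blocks, DirectedDesign19.superSimple_blocks,
    by simp [DirectedDesign19.blocks],
    fun _ hS => le_trans (by norm_num) (DirectedDesign19.card_of_isDefiningSet hS)⟩
end

section
/- There exists a super-simple 4-DGDD of type 3^5 (on 15 points partitioned into 5 groups of size 3, necessarily having 30 blocks) whose smallest defining sets contain at least 15 blocks, i.e. at least half of the blocks. -/
open scoped Classical

/-- Interchanging two points that are adjacent, in opposite orders, in two blocks of a `4`-DGDD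
yields another `4`-DGDD. -/
theorem IsDGDD.swap {β : Type*} {Gs : Multiset (Finset β)} {R : Multiset (List β)}
    {x y a b c d : β} (h : IsDGDD Gs ([x, y, a, b] ::ₘ [y, x, c, d] ::ₘ R)) :
    IsDGDD Gs ([y, x, a, b] ::ₘ [x, y, c, d] ::ₘ R) := by
  obtain ⟨hpart, hblock, hgroup, hcount⟩ := h
  have hp : [x, y, a, b].Perm [y, x, a, b] := List.Perm.swap _ _ _
  have hq : [y, x, c, d].Perm [x, y, c, d] := List.Perm.swap _ _ _
  simp only [Multiset.mem_cons, forall_eq_or_imp] at hblock hgroup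
  obtain ⟨hP, hQ, hR⟩ := hblock
  refine ⟨hpart, ?_, ?_, ?_⟩
  · simp only [Multiset.mem_cons, forall_eq_or_imp]
    exact ⟨⟨hp.nodup_iff.1 hP.1, rfl⟩, ⟨hq.nodup_iff.1 hQ.1, rfl⟩, hR⟩
  · simp only [Multiset.mem_cons, forall_eq_or_imp]
    rwa [← List.toFinset_eq_of_perm _ _ hp, ← List.toFinset_eq_of_perm _ _ hq]
  · intro u v huv hG
    rw [← hcount u v huv hG]
    simp only [Multiset.countP_cons, add_assoc]
    congr 1
    have hPn := hP.1
    have hQn := hQ.1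
    simp only [List.nodup_cons, List.mem_cons, List.not_mem_nil, or_false, not_or] at hPn hQn
    simp only [List.cons_sublist_cons', List.sublist_nil, reduceCtorEq]
    grind

/-- The residue class of `r` modulo `5` in `ℤ/15ℤ`. -/
def residueGroup (r : Fin 5) : Finset (Fin 15) := Finset.univ.filter fun x => x.val % 5 = r.val

/-- The groups of the design: the residue classes modulo `5` in `ℤ/15ℤ`. -/
def residueGroups : Multiset (Finset (Fin 15)) := Finset.univ.val.map residueGroup

/-- The translates of the base block `(0, 1, 3, 7)`. -/
def ascendingBlock (i : Fin 15) : List (Fin 15) := [i, i + 1, i + 3, i + 7]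

/-- The translates of the base block `(1, 0, 13, 9)`. -/
def descendingBlock (i : Fin 15) : List (Fin 15) := [i + 1, i, i + 13, i + 9]

/-- The blocks of the cyclic design on `ℤ/15ℤ`. -/
def cyclicBlocks : Multiset (List (Fin 15)) :=
  Finset.univ.val.map ascendingBlock + Finset.univ.val.map descendingBlock

theorem ascendingBlock_injective : Function.Injective ascendingBlock := by
  intro i j h
  exact (List.cons.inj h).1

theorem descendingBlock_injective : Function.Injective descendingBlock := by
  intro i j h
  exact add_right_cancel (List.cons.inj h).1

theorem ascendingBlock_ne_descendingBlock (i j : Fin 15) :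
    ascendingBlock i ≠ descendingBlock j := by
  revert i j; decide +kernel

theorem mem_cyclicBlocks {b : List (Fin 15)} :
    b ∈ cyclicBlocks ↔ (∃ i, ascendingBlock i = b) ∨ ∃ i, descendingBlock i = b := by
  simp only [cyclicBlocks, Multiset.mem_add, Multiset.mem_map, Finset.mem_val, Finset.mem_univ,
    true_and]

theorem forall_mem_cyclicBlocks {p : List (Fin 15) → Prop} :
    (∀ b ∈ cyclicBlocks, p b) ↔
      (∀ i, p (ascendingBlock i)) ∧ ∀ i, p (descendingBlock i) := by
  simp only [mem_cyclicBlocks, or_imp, forall_and, forall_exists_index, forall_apply_eq_imp_iff]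

theorem forall_mem_residueGroups {p : Finset (Fin 15) → Prop} :
    (∀ G ∈ residueGroups, p G) ↔ ∀ r, p (residueGroup r) := by
  simp only [residueGroups, Multiset.mem_map, Finset.mem_val, Finset.mem_univ, true_and,
    forall_exists_index, forall_apply_eq_imp_iff]

theorem nodup_cyclicBlocks : cyclicBlocks.Nodup := by
  refine Multiset.nodup_add.2 ⟨?_, ?_, ?_⟩
  · exact Finset.univ.nodup.map ascendingBlock_injective
  · exact Finset.univ.nodup.map descendingBlock_injective
  · rw [Multiset.disjoint_left]
    intro b hb hb'
    obtain ⟨i, -, rfl⟩ := Multiset.mem_map.1 hb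
    obtain ⟨j, -, hj⟩ := Multiset.mem_map.1 hb'
    exact ascendingBlock_ne_descendingBlock i j hj.symm

theorem isDGDD_cyclicBlocks : IsDGDD residueGroups cyclicBlocks := by
  refine ⟨?_, ?_, ?_, ?_⟩
  · have h : ∀ x : Fin 15, residueGroups.countP (fun G => x ∈ G) = 1 := by decide +kernel
    convert h
  · simp only [forall_mem_cyclicBlocks, IsBlock]
    decide +kernel
  · have h : ∀ b ∈ cyclicBlocks, ∀ G ∈ residueGroups, (b.toFinset ∩ G).card ≤ 1 := by
      simp only [forall_mem_cyclicBlocks, forall_mem_residueGroups]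
      decide +kernel
    convert h
  · have h : ∀ x y : Fin 15, x ≠ y → (∀ G ∈ residueGroups, ¬(x ∈ G ∧ y ∈ G)) →
        cyclicBlocks.countP (fun b => [x, y].Sublist b) = 1 := by
      simp only [forall_mem_residueGroups]
      decide +kernel
    convert h

theorem superSimple_cyclicBlocks : SuperSimple cyclicBlocks := by
  have h : ∀ b ∈ cyclicBlocks, ∀ c ∈ cyclicBlocks, b ≠ c → (b.toFinset ∩ c.toFinset).card ≤ 2 := by
    simp only [forall_mem_cyclicBlocks]
    decide +kernel
  intro b c hbc
  have hne : b ≠ c := by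
    have := Multiset.nodup_of_le hbc nodup_cyclicBlocks
    simpa using this
  have hb : b ∈ cyclicBlocks := Multiset.mem_of_le hbc (by simp)
  have hc : c ∈ cyclicBlocks := Multiset.mem_of_le hbc (by simp)
  convert h b hb c hc hne

/-- Every defining set of the cyclic design meets each of the `15` disjoint pairs of blocks that
share two consecutive points. -/
theorem mem_or_mem_of_isDGDDDefiningSet {S : Multiset (List (Fin 15))}
    (hS : IsDGDDDefiningSet residueGroups cyclicBlocks S) (i : Fin 15) :
    ascendingBlock i ∈ S ∨ descendingBlock i ∈ S := by
  by_contra! hi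
  obtain ⟨R, hR⟩ : ∃ R, cyclicBlocks = ascendingBlock i ::ₘ descendingBlock i ::ₘ R := by
    obtain ⟨T, hT⟩ := Multiset.exists_cons_of_mem (mem_cyclicBlocks.2 (.inl ⟨i, rfl⟩))
    have hd : descendingBlock i ∈ ascendingBlock i ::ₘ T :=
      hT ▸ mem_cyclicBlocks.2 (.inr ⟨i, rfl⟩)
    obtain ⟨R, rfl⟩ := Multiset.exists_cons_of_mem <|
      (Multiset.mem_cons.1 hd).resolve_left (ascendingBlock_ne_descendingBlock i i).symm
    exact ⟨R, hT⟩
  have hSR : S ≤ R := by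
    have := hS.1
    rwa [hR, Multiset.le_cons_of_notMem hi.1, Multiset.le_cons_of_notMem hi.2] at this
  have hswap := IsDGDD.swap (hR ▸ isDGDD_cyclicBlocks)
  have heq := hS.2 _ hswap
    (hSR.trans ((Multiset.le_cons_self _ _).trans (Multiset.le_cons_self _ _)))
  have hmem : [i + 1, i, i + 3, i + 7] ∈ cyclicBlocks := heq ▸ Multiset.mem_cons_self _ _
  have hnot : ∀ i : Fin 15, [i + 1, i, i + 3, i + 7] ∉ cyclicBlocks := by decide +kernel
  exact hnot i hmem

theorem fifteen_le_card_of_isDGDDDefiningSet {S : Multiset (List (Fin 15))}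
    (hS : IsDGDDDefiningSet residueGroups cyclicBlocks S) : 15 ≤ Multiset.card S := by
  have h (i : Fin 15) : ∃ b ∈ S, b = ascendingBlock i ∨ b = descendingBlock i := by
    rcases mem_or_mem_of_isDGDDDefiningSet hS i with h | h
    exacts [⟨_, h, .inl rfl⟩, ⟨_, h, .inr rfl⟩]
  choose f hfS hf using h
  have hinj : Function.Injective f := by
    intro i j hij
    rcases hf i with hi | hi <;> rcases hf j with hj | hj <;> rw [hi, hj] at hij
    · exact ascendingBlock_injective hij
    · exact absurd hij (ascendingBlock_ne_descendingBlock i j)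
    · exact absurd hij.symm (ascendingBlock_ne_descendingBlock j i)
    · exact descendingBlock_injective hij
  calc 15 = (Finset.univ.val.map f).card := by simp
    _ ≤ S.card := Multiset.card_le_card <|
      (Multiset.le_iff_subset (Finset.univ.nodup.map hinj)).2 fun b hb => by
        obtain ⟨i, -, rfl⟩ := Multiset.mem_map.1 hb
        exact hfS i

/-- There is a super-simple `4`-DGDD of type `3⁵` (15 points,
5 groups of size 3, 30 blocks) whose every defining set contains at least 15
blocks, i.e. at least half of the blocks. -/
theorem stmt18 :
    ∃ (Gs : Multiset (Finset (Fin 15))) (B : Multiset (List (Fin 15))),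
      IsDGDD Gs B ∧ Multiset.card Gs = 5 ∧ (∀ G ∈ Gs, G.card = 3) ∧
      SuperSimple B ∧ Multiset.card B = 30 ∧
      ∀ S : Multiset (List (Fin 15)), IsDGDDDefiningSet Gs B S →
        15 ≤ Multiset.card S := by
  refine ⟨residueGroups, cyclicBlocks, isDGDD_cyclicBlocks, by simp [residueGroups], ?_,
    superSimple_cyclicBlocks, by simp [cyclicBlocks],
    fun S hS => fifteen_le_card_of_isDGDDDefiningSet hS⟩
  rw [forall_mem_residueGroups]
  decide +kernel
end
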